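/- Let g : ℝ^r → [0,∞) be measurable and integrable, let p⊥ be a probability density on ℝ^(m−r), and let q be a probability density on ℝ^r × ℝ^(m−r) that is strictly positive almost everywhere on the set {(x_r, x⊥) : g(x_r)·p⊥(x⊥) > 0}. Let q_r(x_r) = ∫ q(x_r, x⊥) dx⊥ denote the marginal density of q. Then the second moment of the full-space importance sampling estimator dominates that of the marginal estimator: ∫∫ (g(x_r) p⊥(x⊥))² / q(x_r, x⊥) dx_r dx⊥ ≥ ∫ g(x_r)² / q_r(x_r) dx_r (where the integrands are taken to be 0 where the numerator vanishes). -/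

import Mathlib

open MeasureTheory

/-- A tangent-line form of the Cauchy–Schwarz inequality: `a ^ 2 / b` is bounded below by its
tangent planes. -/
theorem two_mul_mul_sub_sq_mul_le_sq_div {a b : ℝ} (hb : 0 ≤ b) (hab : b = 0 → a = 0) (t : ℝ) :
    2 * t * a - t ^ 2 * b ≤ a ^ 2 / b := by
  rcases hb.eq_or_lt with rfl | hb
  · simp [hab rfl]
  · rw [le_div_iff₀ hb]
    nlinarith [sq_nonneg (a - t * b)]

theorem ofReal_integral_le_lintegral_ofReal {α : Type*} [MeasurableSpace α] {μ : Measure α}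
    {f : α → ℝ} (hf : Integrable f μ) :
    ENNReal.ofReal (∫ x, f x ∂μ) ≤ ∫⁻ x, ENNReal.ofReal (f x) ∂μ := by
  rw [integral_eq_lintegral_pos_part_sub_lintegral_neg_part hf]
  exact (ENNReal.ofReal_le_ofReal (sub_le_self _ ENNReal.toReal_nonneg)).trans
    ENNReal.ofReal_toReal_le

/-- The second moment of an importance sampling estimator of `c = ∫ c * p` with unnormalised
proposal `q` is at least `c ^ 2 / ∫ q`. -/
theorem ofReal_sq_div_integral_le_lintegral {α : Type*} [MeasurableSpace α] {μ : Measure α}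
    {p q : α → ℝ} (c : ℝ) (hp : Integrable p μ) (hp_one : ∫ y, p y ∂μ = 1)
    (hq : Integrable q μ) (hq_nonneg : ∀ y, 0 ≤ q y)
    (hpq : ∀ᵐ y ∂μ, q y = 0 → c * p y = 0) :
    ENNReal.ofReal (c ^ 2 / ∫ y, q y ∂μ) ≤
      ∫⁻ y, ENNReal.ofReal ((c * p y) ^ 2 / q y) ∂μ := by
  set Q := ∫ y, q y ∂μ with hQ
  have hint₁ : Integrable (fun y => 2 * (c / Q) * (c * p y)) μ := (hp.const_mul c).const_mul _
  have hint₂ : Integrable (fun y => (c / Q) ^ 2 * q y) μ := hq.const_mul _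
  have hval : ∫ y, (2 * (c / Q) * (c * p y) - (c / Q) ^ 2 * q y) ∂μ = c ^ 2 / Q := by
    rw [integral_sub hint₁ hint₂, integral_const_mul, integral_const_mul, integral_const_mul,
      hp_one, ← hQ]
    rcases eq_or_ne Q 0 with h | h
    · simp [h]
    · field_simp
      ring
  rw [← hval]
  refine (ofReal_integral_le_lintegral_ofReal (hint₁.sub hint₂)).trans (lintegral_mono_ae ?_)
  filter_upwards [hpq] with y hy
  exact ENNReal.ofReal_le_ofReal (two_mul_mul_sub_sq_mul_le_sq_div (hq_nonneg y) hy _)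

/-- Rao–Blackwellisation for importance sampling (second-moment inequality):
the second moment of the full-space IS estimator dominates that of the marginal
estimator. -/
theorem second_moment_full_space_dominates_marginal
    (m r : ℕ)
    (g : (Fin r → ℝ) → ℝ) (hg_meas : Measurable g) (hg_nonneg : ∀ x, 0 ≤ g x)
    (hg_int : Integrable g)
    (pperp : (Fin (m - r) → ℝ) → ℝ) (hp_meas : Measurable pperp)
    (hp_nonneg : ∀ x, 0 ≤ pperp x) (hp_one : ∫ x, pperp x = 1)
    (q : (Fin r → ℝ) × (Fin (m - r) → ℝ) → ℝ) (hq_meas : Measurable q)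
    (hq_nonneg : ∀ x, 0 ≤ q x) (hq_one : ∫ x, q x = 1)
    (hq_pos : ∀ᵐ x : (Fin r → ℝ) × (Fin (m - r) → ℝ),
      0 < g x.1 * pperp x.2 → 0 < q x)
    (qr : (Fin r → ℝ) → ℝ)
    (hqr : ∀ xr, qr xr = ∫ xperp, q (xr, xperp)) :
    ∫⁻ xr, ENNReal.ofReal ((g xr) ^ 2 / qr xr)
      ≤ ∫⁻ x : (Fin r → ℝ) × (Fin (m - r) → ℝ),
          ENNReal.ofReal ((g x.1 * pperp x.2) ^ 2 / q x) := by
  have hp : Integrable pperp := integrable_of_integral_eq_one hp_one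
  have hq : Integrable q := integrable_of_integral_eq_one hq_one
  rw [Measure.volume_eq_prod] at hq hq_pos ⊢
  rw [lintegral_prod _ (by fun_prop)]
  refine lintegral_mono_ae ?_
  filter_upwards [hq.prod_right_ae, Measure.ae_ae_of_ae_prod hq_pos] with x hqx hpos
  rw [hqr x]
  refine ofReal_sq_div_integral_le_lintegral (g x) hp hp_one hqx (fun y => hq_nonneg _) ?_
  filter_upwards [hpos] with y hy hqy
  by_contra hne
  have hgp := (mul_nonneg (hg_nonneg x) (hp_nonneg y)).lt_of_ne' hne
  exact (hy hgp).ne' hqy
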